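/- Let A and B be positive invertible bounded linear operators on a complex Hilbert space H and let m > 0 be a real number such that A - B ≥ m·I. Then log A - log B ≥ (log ‖A‖ - log(‖A‖ - m))·I. -/

import Mathlib

/-- If `A, B` are positive invertible operators on a complex Hilbert space with `A - B ≥ m·I`
for some `m > 0`, then `log A - log B ≥ (log ‖A‖ - log(‖A‖ - m))·I`. -/
theorem log_sub_log_ge_of_sub_ge_smul_one
    {H : Type*} [NormedAddCommGroup H] [InnerProductSpace ℂ H] [CompleteSpace H]
    (A B : H →L[ℂ] H) (hA : 0 ≤ A) (hB : 0 ≤ B) (hAu : IsUnit A) (hBu : IsUnit B)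
    (m : ℝ) (hm : 0 < m) (h : m • (1 : H →L[ℂ] H) ≤ A - B) :
    (Real.log ‖A‖ - Real.log (‖A‖ - m)) • (1 : H →L[ℂ] H) ≤ CFC.log A - CFC.log B := by
  have hAp : IsStrictlyPositive A := hAu.isStrictlyPositive hA
  have hBp : IsStrictlyPositive B := hBu.isStrictlyPositive hB
  have hsa : IsSelfAdjoint A := hA.isSelfAdjoint
  have hle : B ≤ A - m • (1 : H →L[ℂ] H) := le_sub_comm.mp h
  have hCp : IsStrictlyPositive (A - m • (1 : H →L[ℂ] H)) := hBp.of_le hle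
  have hC : cfc (fun x : ℝ => x - m) A = A - m • (1 : H →L[ℂ] H) := by
    rw [cfc_sub (fun x : ℝ => x) (fun _ => m) A, cfc_id' ℝ A, cfc_const m A,
      Algebra.algebraMap_eq_smul_one]
  have hpos : ∀ x ∈ spectrum ℝ A, 0 < x - m := by
    intro x hx
    have h1 : x - m ∈ spectrum ℝ (A - m • (1 : H →L[ℂ] H)) := by
      rw [← hC, cfc_map_spectrum (fun x : ℝ => x - m) A]
      exact ⟨x, hx, rfl⟩
    exact hCp.spectrum_pos h1
  have hlogC : CFC.log (A - m • (1 : H →L[ℂ] H)) = cfc (fun x : ℝ => Real.log (x - m)) A := by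
    rw [← hC, CFC.log]
    refine (cfc_comp' Real.log (fun x : ℝ => x - m) A ?_).symm
    refine Real.continuousOn_log.mono ?_
    rintro _ ⟨x, hx, rfl⟩
    exact (hpos x hx).ne'
  have hc1 : ContinuousOn Real.log (spectrum ℝ A) :=
    Real.continuousOn_log.mono fun x hx => by
      have := hpos x hx
      simp only [Set.mem_compl_iff, Set.mem_singleton_iff]
      linarith
  have hc2 : ContinuousOn (fun x : ℝ => Real.log (x - m)) (spectrum ℝ A) :=
    ContinuousOn.log (by fun_prop) fun x hx => (hpos x hx).ne'
  refine le_trans ?_ (sub_le_sub_left (CFC.log_le_log hle hBp) _)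
  rw [hlogC, CFC.log, ← cfc_sub Real.log (fun x : ℝ => Real.log (x - m)) A hc1 hc2,
    ← Algebra.algebraMap_eq_smul_one]
  refine algebraMap_le_cfc _ _ A ?_ (hc1.sub hc2) hsa
  intro x hx
  have h1 := hpos x hx
  have h3 : 0 < x := by linarith
  have h2 : x ≤ ‖A‖ := by
    by_cases hn : Nontrivial (H →L[ℂ] H)
    · exact (Real.le_norm_self x).trans (spectrum.norm_le_norm_of_mem hx)
    · rw [not_nontrivial_iff_subsingleton] at hn
      simp [spectrum.of_subsingleton] at hx
  have h4 : 0 < ‖A‖ - m := by linarith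
  rw [← Real.log_div (by linarith) h4.ne', ← Real.log_div h3.ne' h1.ne']
  apply Real.log_le_log (div_pos (by linarith) h4)
  rw [div_le_div_iff₀ h4 h1]
  nlinarith
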